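/- Let α be a decision rule whose value J_α(x) := lim_{n→∞} L_αⁿ 0(x) satisfies x ≤ J_α(x) ≤ x + b̄ for all x ≥ 0 (so that, by the fixed point relation L_α J_α = J_α, J_α(x) = α(x) + Γ_α(x − α(x)) for x ≥ 0). Let δ(x) be the greatest maximizer of a ↦ a + Γ_α(x − a) over [0,x]. Then, with ξ* := b̄/(1−β), it holds that δ(x) > 0 for all x > ξ*, and consequently δ(x) ≥ x − ξ* for all x > ξ*. -/

import Mathlib

open MeasureTheory Set Filter Topology

noncomputable section

/-- The constant `b̄ = β ∫ z⁺ ν(dz) / (1-β)`. -/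
def bbar (ν : Measure ℝ) (β : ℝ) : ℝ := β * (∫ z, max z 0 ∂ν) / (1 - β)

/-- The dynamic programming operator `T`. -/
def Tdiv (ν : Measure ℝ) (β γ : ℝ) (v : ℝ → ℝ) (x : ℝ) : ℝ :=
  if 0 ≤ x then
    sSup ((fun a => a - (β / γ) * Real.log
      ((∫ z in Ici (a - x), Real.exp (-(γ * v (x - a + z))) ∂ν)
        + (ν (Iio (a - x))).toReal)) '' Icc 0 x)
  else 0

/-- Membership in the set `S₀`. -/
def memS0 (ν : Measure ℝ) (β : ℝ) (v : ℝ → ℝ) : Prop :=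
  (∀ x, 0 ≤ v x) ∧ (∀ x, 0 ≤ x → v x ≤ x + bbar ν β) ∧ (∀ x, x < 0 → v x = 0)
    ∧ MonotoneOn v (Ici 0) ∧ ContinuousOn v (Ici 0)

/-- Membership in the set `S`. -/
def memS (ν : Measure ℝ) (β : ℝ) (v : ℝ → ℝ) : Prop :=
  (∀ x, 0 ≤ v x) ∧ (∀ x, 0 ≤ x → x ≤ v x ∧ v x ≤ x + bbar ν β) ∧ (∀ x, x < 0 → v x = 0)
    ∧ MonotoneOn v (Ici 0) ∧ ContinuousOn v (Ici 0)

/-- A decision rule. -/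
def DecisionRule (α : ℝ → ℝ) : Prop :=
  Measurable α ∧ (∀ x, 0 ≤ x → α x ∈ Icc 0 x) ∧ (∀ x, x < 0 → α x = 0)

/-- The operator `L_α` associated with a decision rule `α`. -/
def Ldiv (ν : Measure ℝ) (β γ : ℝ) (α : ℝ → ℝ) (v : ℝ → ℝ) (x : ℝ) : ℝ :=
  if 0 ≤ x then
    α x - (β / γ) * Real.log
      ((∫ z in Ici (α x - x), Real.exp (-(γ * v (x - α x + z))) ∂ν)
        + (ν (Iio (α x - x))).toReal)
  else 0

/-- The function `Γ` associated with a value function `J`. -/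
def Gam (ν : Measure ℝ) (β γ : ℝ) (J : ℝ → ℝ) (x : ℝ) : ℝ :=
  -(β / γ) * Real.log
    ((∫ z in Ici (-x), Real.exp (-(γ * J (x + z))) ∂ν) + (ν (Iio (-x))).toReal)

end

theorem Ldiv_measurable {ν : Measure ℝ} [IsProbabilityMeasure ν] {β γ : ℝ} {α v : ℝ → ℝ}
    (hα : Measurable α) (hv : Measurable v) : Measurable (Ldiv ν β γ α v) := by
  have hint : Measurable fun x =>
      ∫ z in Ici (α x - x), Real.exp (-(γ * v (x - α x + z))) ∂ν := by
    have hset : MeasurableSet {p : ℝ × ℝ | α p.1 - p.1 ≤ p.2} :=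
      measurableSet_le (by fun_prop) (by fun_prop)
    have hmeas : Measurable ({p : ℝ × ℝ | α p.1 - p.1 ≤ p.2}.indicator
        fun p => Real.exp (-(γ * v (p.1 - α p.1 + p.2)))) :=
      Measurable.indicator (by fun_prop) hset
    convert (hmeas.stronglyMeasurable.integral_prod_right' (ν := ν)).measurable using 2 with x
    rw [← integral_indicator measurableSet_Ici]
    rfl
  have hcdf : Measurable fun x => (ν (Iio (α x - x))).toReal := by
    have hmono : Monotone fun y => ν (Iio y) := fun a b hab => measure_mono (Iio_subset_Iio hab)
    exact (hmono.measurable.comp (hα.sub measurable_id)).ennreal_toReal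
  exact Measurable.ite measurableSet_Ici
    (hα.sub ((Real.measurable_log.comp (hint.add hcdf)).const_mul _)) measurable_const

theorem measurable_of_tendsto_Ldiv_iterate {ν : Measure ℝ} [IsProbabilityMeasure ν] {β γ : ℝ}
    {α J : ℝ → ℝ} (hα : Measurable α)
    (hJ : ∀ x, Tendsto (fun n => (Ldiv ν β γ α)^[n] (fun _ => 0) x) atTop (𝓝 (J x))) :
    Measurable J := by
  refine measurable_of_tendsto_metrizable (fun n => ?_) (tendsto_pi_nhds.2 hJ)
  induction n with
  | zero => exact measurable_const
  | succ n ih =>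
    rw [Function.iterate_succ_apply']
    exact Ldiv_measurable hα ih

theorem integrableOn_exp_neg_shift {ν : Measure ℝ} [IsProbabilityMeasure ν] {γ x : ℝ}
    {J : ℝ → ℝ} (hγ : 0 < γ) (hJ : Measurable J) (hJ0 : ∀ y, 0 ≤ y → 0 ≤ J y) :
    IntegrableOn (fun z => Real.exp (-(γ * J (x + z)))) (Ici (-x)) ν := by
  have hmeas : Measurable fun z => Real.exp (-(γ * J (x + z))) := by fun_prop
  refine Integrable.of_bound hmeas.aestronglyMeasurable 1 ?_
  filter_upwards [ae_restrict_mem measurableSet_Ici] with z hz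
  have hz : -x ≤ z := hz
  rw [Real.norm_of_nonneg (Real.exp_pos _).le, Real.exp_le_one_iff, neg_nonpos]
  exact mul_nonneg hγ.le (hJ0 _ (by linarith))

theorem Gam_nonneg {ν : Measure ℝ} [IsProbabilityMeasure ν] {β γ x : ℝ} {J : ℝ → ℝ}
    (hβ : 0 ≤ β) (hγ : 0 < γ) (hJ : Measurable J) (hJ0 : ∀ y, 0 ≤ y → 0 ≤ J y) :
    0 ≤ Gam ν β γ J x := by
  have hle : ∫ z in Ici (-x), Real.exp (-(γ * J (x + z))) ∂ν ≤ ∫ _ in Ici (-x), (1 : ℝ) ∂ν := by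
    refine setIntegral_mono_on (integrableOn_exp_neg_shift hγ hJ hJ0)
      (integrable_const _).integrableOn measurableSet_Ici fun z hz => ?_
    have hz : -x ≤ z := hz
    rw [Real.exp_le_one_iff, neg_nonpos]
    exact mul_nonneg hγ.le (hJ0 _ (by linarith))
  have hIio : (ν (Iio (-x))).toReal = ∫ _ in Iio (-x), (1 : ℝ) ∂ν := by
    simp [Measure.real]
  have hsum : ∫ _ in Ici (-x), (1 : ℝ) ∂ν + ∫ _ in Iio (-x), (1 : ℝ) ∂ν = 1 := by
    rw [← compl_Ici, integral_add_compl measurableSet_Ici (integrable_const _)]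
    simp
  have hpos : 0 ≤ ∫ z in Ici (-x), Real.exp (-(γ * J (x + z))) ∂ν :=
    integral_nonneg fun z => (Real.exp_pos _).le
  have hlog := Real.log_nonpos (add_nonneg hpos ENNReal.toReal_nonneg)
    (by rw [hIio]; linarith : _ + (ν (Iio (-x))).toReal ≤ 1)
  exact mul_nonneg_of_nonpos_of_nonpos (neg_nonpos.2 (div_nonneg hβ hγ.le)) hlog

theorem Gam_le_of_le_add {ν : Measure ℝ} [IsProbabilityMeasure ν] {β γ x b : ℝ} {J : ℝ → ℝ}
    (hint : Integrable (fun z => max z 0) ν) (hβ : 0 ≤ β) (hγ : 0 < γ) (hJ : Measurable J)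
    (hJ0 : ∀ y, 0 ≤ y → 0 ≤ J y) (hJb : ∀ y, 0 ≤ y → J y ≤ y + b) (hb : 0 ≤ b) (hx : 0 ≤ x) :
    Gam ν β γ J x ≤ β * (x + b + ∫ z, max z 0 ∂ν) := by
  set m := ∫ z, max z 0 ∂ν
  set g : ℝ → ℝ := fun z => Real.exp (-(γ * (x + b + m))) * (1 - γ * (max z 0 - m))
  have hdev : Integrable (fun z => γ * (max z 0 - m)) ν :=
    (hint.sub (integrable_const m)).const_mul γ
  have hg : Integrable g ν := ((integrable_const _).sub hdev).const_mul _
  have hgint : ∫ z, g z ∂ν = Real.exp (-(γ * (x + b + m))) := by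
    simp only [g]
    rw [integral_const_mul, integral_sub (integrable_const _) hdev, integral_const_mul,
      integral_sub hint (integrable_const _)]
    simp [m]
  have hgle (z : ℝ) : g z ≤ Real.exp (-(γ * (x + b + max z 0))) := by
    have h := Real.add_one_le_exp (-(γ * (max z 0 - m)))
    calc g z ≤ Real.exp (-(γ * (x + b + m))) * Real.exp (-(γ * (max z 0 - m))) :=
          mul_le_mul_of_nonneg_left (by linarith) (Real.exp_pos _).le
      _ = Real.exp (-(γ * (x + b + max z 0))) := by rw [← Real.exp_add]; ring_nf
  have hIci : ∫ z in Ici (-x), g z ∂ν ≤ ∫ z in Ici (-x), Real.exp (-(γ * J (x + z))) ∂ν := by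
    refine setIntegral_mono_on hg.integrableOn (integrableOn_exp_neg_shift hγ hJ hJ0)
      measurableSet_Ici fun z hz => (hgle z).trans ?_
    have hz : -x ≤ z := hz
    have hJz := hJb (x + z) (by linarith)
    have hmax := le_max_left z 0
    exact Real.exp_le_exp.2 (neg_le_neg (mul_le_mul_of_nonneg_left (by linarith) hγ.le))
  have hIio : ∫ z in Iio (-x), g z ∂ν ≤ (ν (Iio (-x))).toReal := by
    have h : ∫ z in Iio (-x), g z ∂ν ≤ ∫ _ in Iio (-x), (1 : ℝ) ∂ν := by
      refine setIntegral_mono_on hg.integrableOn (integrable_const _).integrableOn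
        measurableSet_Iio fun z _ => (hgle z).trans ?_
      rw [Real.exp_le_one_iff, neg_nonpos]
      positivity
    simpa [Measure.real] using h
  have hsum : ∫ z in Ici (-x), g z ∂ν + ∫ z in Iio (-x), g z ∂ν = ∫ z, g z ∂ν := by
    rw [← compl_Ici, integral_add_compl measurableSet_Ici hg]
  have hlog := Real.log_le_log (Real.exp_pos (-(γ * (x + b + m))))
    (by linarith : _ ≤ (∫ z in Ici (-x), Real.exp (-(γ * J (x + z))) ∂ν)
      + (ν (Iio (-x))).toReal)
  rw [Real.log_exp] at hlog
  calc Gam ν β γ J x ≤ -(β / γ) * -(γ * (x + b + m)) :=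
        mul_le_mul_of_nonpos_left hlog (neg_nonpos.2 (div_nonneg hβ hγ.le))
    _ = β * (x + b + m) := by field_simp

theorem bbar_nonneg {ν : Measure ℝ} {β : ℝ} (hβ : β ∈ Ioo (0 : ℝ) 1) : 0 ≤ bbar ν β :=
  div_nonneg (mul_nonneg hβ.1.le (integral_nonneg fun z => le_max_right z 0))
    (sub_nonneg.2 hβ.2.le)

/-- in the policy improvement step, with `ξ* = b̄/(1-β)`,
the improved rule `δ` satisfies `δ(x) > 0` and hence `δ(x) ≥ x - ξ*`
for all `x > ξ*`. -/
theorem improvement_pays_above_xi_star (ν : Measure ℝ) [IsProbabilityMeasure ν]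
    (hac : ν ≪ volume) (hint : Integrable (fun z => max z 0) ν)
    (hneg : 0 < ν (Iio 0)) (β γ : ℝ) (hβ : β ∈ Ioo (0:ℝ) 1) (hγ : 0 < γ)
    (α : ℝ → ℝ) (hα : DecisionRule α) (Jα : ℝ → ℝ)
    (hJα : ∀ x : ℝ, Tendsto (fun n => (Ldiv ν β γ α)^[n] (fun _ => 0) x)
      atTop (𝓝 (Jα x)))
    (hJαb : ∀ x : ℝ, 0 ≤ x → x ≤ Jα x ∧ Jα x ≤ x + bbar ν β)
    (δ : ℝ → ℝ)
    (hδ : ∀ x : ℝ, 0 ≤ x →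
      IsGreatest {a | a ∈ Icc 0 x ∧
        ∀ a' ∈ Icc 0 x, a' + Gam ν β γ Jα (x - a') ≤ a + Gam ν β γ Jα (x - a)}
        (δ x)) :
    ∀ x : ℝ, bbar ν β / (1 - β) < x →
      0 < δ x ∧ x - bbar ν β / (1 - β) ≤ δ x := by
  obtain ⟨hβ0, hβ1⟩ := hβ
  have h1β : 0 < 1 - β := sub_pos.2 hβ1
  have hb : 0 ≤ bbar ν β := bbar_nonneg ⟨hβ0, hβ1⟩
  have hξ : 0 ≤ bbar ν β / (1 - β) := div_nonneg hb h1β.le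
  have hJ : Measurable Jα := measurable_of_tendsto_Ldiv_iterate hα.1 hJα
  have hJ0 (y : ℝ) (hy : 0 ≤ y) : 0 ≤ Jα y := hy.trans (hJαb y hy).1
  have hpos (x : ℝ) (hx : bbar ν β / (1 - β) < x) : 0 < δ x := by
    have hx0 : 0 ≤ x := hξ.trans hx.le
    obtain ⟨⟨hmem, hmax⟩, -⟩ := hδ x hx0
    refine hmem.1.lt_of_ne' fun h0 => ?_
    have hpay := hmax x ⟨hx0, le_rfl⟩
    rw [h0, sub_self, sub_zero, zero_add] at hpay
    have hlow : 0 ≤ Gam ν β γ Jα 0 := Gam_nonneg hβ0.le hγ hJ hJ0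
    have hup : Gam ν β γ Jα x ≤ β * (x + bbar ν β + ∫ z, max z 0 ∂ν) :=
      Gam_le_of_le_add hint hβ0.le hγ hJ hJ0 (fun y hy => (hJαb y hy).2) hb hx0
    have hbbar : bbar ν β * (1 - β) = β * ∫ z, max z 0 ∂ν := div_mul_cancel₀ _ h1β.ne'
    have hlt := (div_lt_iff₀ h1β).1 hx
    linarith
  intro x hx
  refine ⟨hpos x hx, ?_⟩
  obtain ⟨⟨hmem, hmax⟩, hgreatest⟩ := hδ x (hξ.trans hx.le)
  by_contra! hlt
  have hy : bbar ν β / (1 - β) < x - δ x := by linarith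
  obtain ⟨⟨hymem, hymax⟩, -⟩ := hδ (x - δ x) (hξ.trans hy.le)
  have hypos := hpos _ hy
  have hle := hgreatest (a := δ x + δ (x - δ x))
    ⟨⟨by linarith [hmem.1], by linarith [hymem.2]⟩, fun a' ha' => by
      have h1 := hmax a' ha'
      have h2 := hymax 0 ⟨le_rfl, sub_nonneg.2 hmem.2⟩
      rw [sub_zero, zero_add] at h2
      rw [← sub_sub]
      linarith⟩
  linarith
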